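/- (q-deformed Euler–Minding formula) For every k ≥ 1 and positive integers c_1,…,c_k, one has E_k(c_1,…,c_k)_q = Σ_S (∏_{i∈S} (−q^{c_i−1})) · (∏_{j ∈ {1,…,k} \ (S ∪ (S+1))} [c_j]_q), where the sum runs over all subsets S ⊆ {1,…,k−1} containing no two consecutive integers, and S+1 = {i+1 : i ∈ S}. -/

import Mathlib

/-- The `q`-integer `[c]_q = 1 + q + ⋯ + q^{c-1}` in `ℤ[q]`. -/
noncomputable def qN (c : ℕ) : Polynomial ℤ := ∑ i ∈ Finset.range c, Polynomial.X ^ i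

/-- The tridiagonal matrix whose determinant is the `q`-continuant
`E_k(c_1,…,c_k)_q` (here `c` is 0-indexed: `c 0 = c_1`). -/
noncomputable def Emat (k : ℕ) (c : ℕ → ℕ) : Matrix (Fin k) (Fin k) (Polynomial ℤ) :=
  Matrix.of fun i j =>
    if (i : ℕ) = (j : ℕ) then qN (c i)
    else if (j : ℕ) = (i : ℕ) + 1 then Polynomial.X ^ (c i - 1)
    else if (i : ℕ) = (j : ℕ) + 1 then 1
    else 0

/-- The `q`-continuant `E_k(c_1,…,c_k)_q ∈ ℤ[q]` (0-indexed `c`); `Econt 0 c = 1`. -/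
noncomputable def Econt (k : ℕ) (c : ℕ → ℕ) : Polynomial ℤ := (Emat k c).det

/-- The matrix `M(c_1,…,c_k)_q = ∏_{i=1}^{k} [[ [c_i]_q, −q^{c_i−1} ], [1, 0]]` over `ℤ[q]`. -/
noncomputable def Mmat (k : ℕ) (c : ℕ → ℕ) : Matrix (Fin 2) (Fin 2) (Polynomial ℤ) :=
  ((List.range k).map fun i => !![qN (c i), -(Polynomial.X ^ (c i - 1)); 1, 0]).prod

theorem Econt_rec (k : ℕ) (c : ℕ → ℕ) :
    Econt (k + 2) c = qN (c (k + 1)) * Econt (k + 1) c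
      + -(Polynomial.X ^ (c k - 1)) * Econt k c := by
  unfold Econt
  rw [Matrix.det_succ_row _ (Fin.last (k + 1)), Fin.sum_univ_castSucc, Fin.sum_univ_castSucc]
  have h0 : ∀ j : Fin k, Emat (k + 2) c (Fin.last (k + 1)) j.castSucc.castSucc = 0 := by
    intro j
    have := j.2
    simp only [Emat, Matrix.of_apply, Fin.val_last, Fin.val_castSucc]
    rw [if_neg (by omega), if_neg (by omega), if_neg (by omega)]
  have h1 : Emat (k + 2) c (Fin.last (k + 1)) (Fin.last k).castSucc = 1 := by
    simp [Emat]; omega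
  have h2 : Emat (k + 2) c (Fin.last (k + 1)) (Fin.last (k + 1)) = qN (c (k + 1)) := by
    simp [Emat]
  have h3 : (Emat (k + 2) c).submatrix (Fin.last (k + 1)).succAbove (Fin.last (k + 1)).succAbove
      = Emat (k + 1) c := by
    ext1 i j
    simp [Emat]
  have h4 : ((Emat (k + 2) c).submatrix (Fin.last (k + 1)).succAbove
      (Fin.last k).castSucc.succAbove).det = Polynomial.X ^ (c k - 1) * (Emat k c).det := by
    rw [Matrix.det_succ_column _ (Fin.last k), Fin.sum_univ_castSucc]
    have e0 : ∀ i : Fin k, (Emat (k + 2) c).submatrix (Fin.last (k + 1)).succAbove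
        (Fin.last k).castSucc.succAbove i.castSucc (Fin.last k) = 0 := by
      intro i
      have := i.2
      simp only [Emat, Matrix.submatrix_apply, Matrix.of_apply, Fin.succAbove_last,
        Fin.succAbove_castSucc_self, Fin.val_succ, Fin.val_last, Fin.val_castSucc]
      rw [if_neg (by omega), if_neg (by omega), if_neg (by omega)]
    have e1 : (Emat (k + 2) c).submatrix (Fin.last (k + 1)).succAbove
        (Fin.last k).castSucc.succAbove (Fin.last k) (Fin.last k) = Polynomial.X ^ (c k - 1) := by
      simp [Emat]
    have e2 : ((Emat (k + 2) c).submatrix (Fin.last (k + 1)).succAbove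
        (Fin.last k).castSucc.succAbove).submatrix (Fin.last k).succAbove (Fin.last k).succAbove
        = Emat k c := by
      ext1 i j
      have hj : (Fin.last k).castSucc.succAbove j.castSucc = j.castSucc.castSucc :=
        Fin.succAbove_of_castSucc_lt _ _ (by simp [Fin.lt_def])
      simp [Emat, hj]
    simp only [e0, e1, e2, Fin.val_last, ← two_mul, mul_zero, zero_mul, Finset.sum_const_zero,
      pow_mul]
    simp
  simp only [h0, h1, h2, h3, h4, mul_zero, zero_mul, Finset.sum_const_zero]
  have s1 : (-1 : Polynomial ℤ) ^ (k + 1 + k) = -1 := Odd.neg_one_pow ⟨k, by ring⟩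
  have s2 : (-1 : Polynomial ℤ) ^ (k + 1 + (k + 1)) = 1 := Even.neg_one_pow ⟨k + 1, rfl⟩
  simp only [Fin.val_last, Fin.val_castSucc, s1, s2]
  ring

/-- The right-hand side of the Euler–Minding formula. -/
noncomputable def EMsum (k : ℕ) (c : ℕ → ℕ) : Polynomial ℤ :=
  ∑ S ∈ (Finset.range (k - 1)).powerset.filter (fun S => ∀ i ∈ S, i + 1 ∉ S),
    (∏ i ∈ S, -(Polynomial.X ^ (c i - 1))) *
      ∏ j ∈ Finset.range k \ (S ∪ S.image (· + 1)), qN (c j)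

theorem EMsum_rec (k : ℕ) (c : ℕ → ℕ) :
    EMsum (k + 2) c = qN (c (k + 1)) * EMsum (k + 1) c
      + -(Polynomial.X ^ (c k - 1)) * EMsum k c := by
  unfold EMsum
  rw [show k + 2 - 1 = k + 1 from rfl, show k + 1 - 1 = k from rfl, Finset.sum_filter,
    Finset.range_add_one (n := k), Finset.sum_powerset_insert Finset.notMem_range_self]
  congr 1
  · rw [← Finset.sum_filter, Finset.mul_sum]
    refine Finset.sum_congr rfl fun S hS => ?_
    simp only [Finset.mem_filter, Finset.mem_powerset] at hS
    have hlt : ∀ i ∈ S, i < k := fun i hi => Finset.mem_range.1 (hS.1 hi)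
    have : Finset.range (k + 2) \ (S ∪ S.image (· + 1))
        = insert (k + 1) (insert k (Finset.range k) \ (S ∪ S.image (· + 1))) := by
      ext x
      simp only [Finset.mem_sdiff, Finset.mem_union, Finset.mem_image, Finset.mem_range,
        Finset.mem_insert]
      constructor
      · rintro ⟨h, h'⟩
        by_cases hx : x = k + 1
        · exact Or.inl hx
        · exact Or.inr ⟨by omega, h'⟩
      · rintro (rfl | ⟨h, h'⟩)
        · refine ⟨by omega, ?_⟩
          rintro (h | ⟨a, h, h'⟩)
          · have := hlt _ h
            omega
          · have := hlt _ h
            omega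
        · exact ⟨by omega, h'⟩
    rw [this, Finset.prod_insert (by simp)]
    ring
  · rw [← Finset.sum_filter, Finset.mul_sum]
    have hset : (Finset.range k).powerset.filter
          (fun S => ∀ i ∈ insert k S, i + 1 ∉ insert k S)
        = (Finset.range (k - 1)).powerset.filter (fun S => ∀ i ∈ S, i + 1 ∉ S) := by
      ext S
      simp only [Finset.mem_filter, Finset.mem_powerset, Finset.subset_iff, Finset.mem_range,
        Finset.mem_insert]
      constructor
      · rintro ⟨h, h'⟩
        refine ⟨fun x hx => ?_, fun i hi hi' => h' i (Or.inr hi) (Or.inr hi')⟩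
        have h1 := h hx
        have h2 : x + 1 ≠ k := fun e => h' x (Or.inr hx) (Or.inl e)
        omega
      · rintro ⟨h, h'⟩
        refine ⟨fun x hx => by have := h hx; omega, ?_⟩
        rintro i (rfl | hi) (hj | hj)
        · omega
        · have := h hj
          omega
        · have := h hi
          omega
        · exact h' i hi hj
    rw [hset]
    refine Finset.sum_congr rfl fun S hS => ?_
    simp only [Finset.mem_filter, Finset.mem_powerset] at hS
    have hlt : ∀ i ∈ S, i < k - 1 := fun i hi => Finset.mem_range.1 (hS.1 hi)
    have : Finset.range (k + 2) \ (insert k S ∪ (insert k S).image (· + 1))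
        = Finset.range k \ (S ∪ S.image (· + 1)) := by
      ext x
      simp only [Finset.mem_sdiff, Finset.mem_union, Finset.mem_image, Finset.mem_range,
        Finset.mem_insert]
      constructor
      · rintro ⟨h, h'⟩
        have h1 : x ≠ k := fun e => h' (Or.inl (Or.inl e))
        have h2 : x ≠ k + 1 := fun e => h' (Or.inr ⟨k, Or.inl rfl, e.symm⟩)
        refine ⟨by omega, ?_⟩
        rintro (h | ⟨a, ha, e⟩)
        · exact h' (Or.inl (Or.inr h))
        · exact h' (Or.inr ⟨a, Or.inr ha, e⟩)
      · rintro ⟨h, h'⟩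
        refine ⟨by omega, ?_⟩
        rintro ((h1 | h1) | ⟨a, h1 | h1, e⟩)
        · omega
        · exact h' (Or.inl h1)
        · omega
        · exact h' (Or.inr ⟨a, h1, e⟩)
    rw [this, Finset.prod_insert (fun h => by have := hlt _ h; omega)]
    ring

theorem Econt_eq_EMsum (c : ℕ → ℕ) : ∀ k : ℕ, Econt k c = EMsum k c
  | 0 => by simp [Econt, EMsum, Finset.filter_singleton]
  | 1 => by simp [Econt, EMsum, Emat, Finset.filter_singleton]
  | k + 2 => by
    rw [Econt_rec, EMsum_rec, Econt_eq_EMsum c (k + 1), Econt_eq_EMsum c k]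

/-- q-deformed Euler–Minding formula: for `k ≥ 1` and positive integers
`c_1,…,c_k` (0-indexed: subsets `S` of `{0,…,k−2}` with no two consecutive elements),
`E_k(c_1,…,c_k)_q = Σ_S (∏_{i∈S} (−q^{c_i−1})) · (∏_{j ∉ S ∪ (S+1)} [c_j]_q)`. -/
theorem Econt_euler_minding (k : ℕ) (hk : 1 ≤ k) (c : ℕ → ℕ) (hc : ∀ i < k, 0 < c i) :
    Econt k c =
      ∑ S ∈ (Finset.range (k - 1)).powerset.filter (fun S => ∀ i ∈ S, i + 1 ∉ S),
        (∏ i ∈ S, -(Polynomial.X ^ (c i - 1))) *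
          ∏ j ∈ Finset.range k \ (S ∪ S.image (· + 1)), qN (c j) := by
  exact Econt_eq_EMsum c k
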